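/- Let p be a prime, n an even positive integer, and s a positive integer with s ≤ n/2, where p is odd or s ≥ 2. Let F : V_n → V_s be a vectorial dual-bent function satisfying Condition A with sign ε ∈ {1,−1} (ε = 1 if p = 2). Then the fiber of F over F(0) has cardinality |F⁻¹(F(0))| = p^{n−s} + ε·p^{n/2−s}·(p^s − 1), and for every i ∈ V_s with i ≠ F(0), |F⁻¹(i)| = p^{n−s} − ε·p^{n/2−s}. -/

import Mathlib

open Finset

/-- `ζ_p^t = exp(2πi·t.val/p)` for `t : ZMod p`. -/
noncomputable def zetaP (p : ℕ) (t : ZMod p) : ℂ :=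
  Complex.exp (2 * Real.pi * Complex.I * (t.val : ℂ) / (p : ℂ))

/-- The standard inner product on `V_n = Fin n → ZMod p`. -/
def ip {p n : ℕ} (a x : Fin n → ZMod p) : ZMod p := ∑ i, a i * x i

/-- The Walsh transform of `f : V_n → ZMod p`. -/
noncomputable def walsh {p n : ℕ} [NeZero p] (f : (Fin n → ZMod p) → ZMod p)
    (a : Fin n → ZMod p) : ℂ :=
  ∑ x : Fin n → ZMod p, zetaP p (f x - ip a x)

/-- `F : V_n → V_s` is a vectorial dual-bent function satisfying Condition A with sign `ε`. -/
def ConditionA {n s : ℕ} (p : ℕ) [NeZero p]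
    (F : (Fin n → ZMod p) → (Fin s → ZMod p)) (ε : ℤ) : Prop :=
  ∃ Fd : (Fin n → ZMod p) → (Fin s → ZMod p),
    ∀ c : Fin s → ZMod p, c ≠ 0 → ∀ a : Fin n → ZMod p,
      walsh (fun x => ip c (F x)) a = (ε : ℂ) * (p : ℂ) ^ (n / 2) * zetaP p (ip c (Fd a))

lemma zetaP_eq_stdAddChar (p : ℕ) [NeZero p] (t : ZMod p) :
    zetaP p t = ZMod.stdAddChar t := by
  conv_rhs => rw [← ZMod.natCast_zmod_val t, ← Int.cast_natCast, ZMod.stdAddChar_coe]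
  simp [zetaP]

section InnerProduct

variable {p n : ℕ}

lemma ip_comm (a x : Fin n → ZMod p) : ip a x = ip x a := dotProduct_comm a x

lemma ip_zero (a : Fin n → ZMod p) : ip a 0 = 0 := dotProduct_zero a

lemma zero_ip (x : Fin n → ZMod p) : ip 0 x = 0 := zero_dotProduct x

lemma ip_add (a x y : Fin n → ZMod p) : ip a (x + y) = ip a x + ip a y := dotProduct_add a x y

lemma ip_sub (a x y : Fin n → ZMod p) : ip a (x - y) = ip a x - ip a y := dotProduct_sub a x y

lemma sub_ip (a b x : Fin n → ZMod p) : ip (a - b) x = ip a x - ip b x := sub_dotProduct a b x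

/-- Orthogonality of the additive characters of `V_n`. -/
lemma sum_stdAddChar_ip [NeZero p] (a : Fin n → ZMod p) :
    ∑ x : Fin n → ZMod p, (ZMod.stdAddChar (ip x a) : ℂ) = if a = 0 then (p : ℂ) ^ n else 0 := by
  split_ifs with ha
  · simp [ha, ip_zero]
  · let φ : (Fin n → ZMod p) →+ ZMod p := AddMonoidHom.mk' (ip a) (ip_add a)
    let χ : AddChar (Fin n → ZMod p) ℂ := (ZMod.stdAddChar (N := p)).compAddMonoidHom φ
    have hχ : χ ≠ 1 := by
      intro h
      refine ha (funext fun i => ?_)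
      have hi : (ZMod.stdAddChar (ip a (Pi.single i 1)) : ℂ) = ZMod.stdAddChar (0 : ZMod p) := by
        rw [AddChar.map_zero_eq_one]
        exact DFunLike.congr_fun h (Pi.single i 1)
      simpa [ip, Pi.single_apply] using ZMod.injective_stdAddChar hi
    simp_rw [ip_comm _ a]
    exact AddChar.sum_eq_zero_of_ne_one hχ

end InnerProduct

section Walsh

variable {p n : ℕ} [NeZero p]

lemma walsh_eq (f : (Fin n → ZMod p) → ZMod p) (a : Fin n → ZMod p) :
    walsh f a = ∑ x, (ZMod.stdAddChar (f x) : ℂ) * ZMod.stdAddChar (-ip a x) := by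
  simp [walsh, zetaP_eq_stdAddChar, sub_eq_add_neg, AddChar.map_add_eq_mul]

lemma conj_stdAddChar (t : ZMod p) :
    (starRingEnd ℂ) (ZMod.stdAddChar t) = ZMod.stdAddChar (-t) :=
  (AddChar.map_neg_eq_conj _ t).symm

/-- Fourier inversion at the origin. -/
lemma sum_walsh (f : (Fin n → ZMod p) → ZMod p) :
    ∑ a, walsh f a = (p : ℂ) ^ n * ZMod.stdAddChar (f 0) := by
  simp_rw [walsh_eq]
  rw [Finset.sum_comm]
  have h (x a : Fin n → ZMod p) : -ip a x = ip a (0 - x) := by rw [ip_sub, ip_zero, zero_sub]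
  simp_rw [← Finset.mul_sum, h, sum_stdAddChar_ip]
  simp [mul_comm]

/-- Parseval's identity for the Walsh transform. -/
lemma sum_walsh_mul_conj_walsh (f g : (Fin n → ZMod p) → ZMod p) :
    ∑ a, walsh f a * (starRingEnd ℂ) (walsh g a) =
      (p : ℂ) ^ n * ∑ x, (ZMod.stdAddChar (f x - g x) : ℂ) := by
  have h (a x y : Fin n → ZMod p) :
      (ZMod.stdAddChar (f x) : ℂ) * ZMod.stdAddChar (-ip a x) *
        (ZMod.stdAddChar (-g y) * ZMod.stdAddChar (- -ip a y)) =
      ZMod.stdAddChar (f x - g y) * ZMod.stdAddChar (ip a (y - x)) := by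
    simp only [← AddChar.map_add_eq_mul, ip_sub]
    congr 1
    ring
  simp_rw [walsh_eq, map_sum, map_mul, conj_stdAddChar, Finset.sum_mul_sum, h]
  rw [Finset.sum_comm, Finset.mul_sum]
  refine Finset.sum_congr rfl fun x _ => ?_
  rw [Finset.sum_comm]
  simp_rw [← Finset.mul_sum, sum_stdAddChar_ip, sub_eq_zero]
  simp [mul_comm]

end Walsh

lemma exists_ne_zero_sub_eq {V : Type*} [AddCommGroup V] [Fintype V]
    (hV : 2 < Fintype.card V) (c : V) : ∃ e d : V, e ≠ 0 ∧ d ≠ 0 ∧ e - d = c := by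
  classical
  obtain ⟨d, hd⟩ : ∃ d, d ∉ ({0, -c} : Finset V) := by
    by_contra! h
    have := Finset.card_le_card (fun d _ => h d : (Finset.univ : Finset V) ⊆ {0, -c})
    rw [Finset.card_univ] at this
    exact absurd (this.trans Finset.card_le_two) (by omega)
  simp only [Finset.mem_insert, Finset.mem_singleton, not_or] at hd
  exact ⟨c + d, d, fun h => hd.2 (eq_neg_of_add_eq_zero_right h), hd.1, by abel⟩

/-- The vectorial dual of `F` takes the same value as `F` at the origin. -/
lemma vectorialDual_zero {p n s : ℕ} [NeZero p] (hneven : Even n)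
    (hcard : 2 < p ^ s) {F Fd : (Fin n → ZMod p) → (Fin s → ZMod p)} {ε : ℤ}
    (hε : ε = 1 ∨ ε = -1)
    (hF : ∀ c : Fin s → ZMod p, c ≠ 0 → ∀ a : Fin n → ZMod p,
      walsh (fun x => ip c (F x)) a = (ε : ℂ) * (p : ℂ) ^ (n / 2) * zetaP p (ip c (Fd a))) :
    Fd 0 = F 0 := by
  have hp : (p : ℂ) ≠ 0 := Nat.cast_ne_zero.mpr (NeZero.ne p)
  have hεε : (ε : ℂ) * ε = 1 := by rcases hε with rfl | rfl <;> simp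
  have hpn : (p : ℂ) ^ (n / 2) * (p : ℂ) ^ (n / 2) = (p : ℂ) ^ n := by
    rw [← pow_add, ← two_mul, Nat.two_mul_div_two_of_even hneven]
  simp_rw [zetaP_eq_stdAddChar] at hF
  have key (c : Fin s → ZMod p) : ip c (Fd 0) = ip c (F 0) := by
    by_cases hc : c = 0
    · simp [hc, zero_ip]
    obtain ⟨e, d, he, hd, rfl⟩ := exists_ne_zero_sub_eq (by simpa using hcard) c
    have hpars := sum_walsh_mul_conj_walsh (fun x => ip e (F x)) (fun x => ip d (F x))
    have hinv := sum_walsh (fun x => ip (e - d) (F x))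
    have hzero := hF _ hc 0
    simp_rw [walsh_eq, zero_ip, neg_zero, AddChar.map_zero_eq_one, mul_one] at hzero
    have hterm (a : Fin n → ZMod p) :
        walsh (fun x => ip e (F x)) a * (starRingEnd ℂ) (walsh (fun x => ip d (F x)) a) =
          (p : ℂ) ^ n * ZMod.stdAddChar (ip (e - d) (Fd a)) := by
      rw [hF e he, hF d hd, sub_ip, sub_eq_add_neg, AddChar.map_add_eq_mul]
      simp only [map_mul, map_pow, map_intCast, map_natCast, conj_stdAddChar]
      linear_combination (ZMod.stdAddChar (ip e (Fd a)) : ℂ) * ZMod.stdAddChar (-ip d (Fd a)) *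
        ((p : ℂ) ^ (n / 2) * (p : ℂ) ^ (n / 2) * hεε + hpn)
    simp_rw [hterm, ← Finset.mul_sum, ← sub_ip] at hpars
    have hsum := mul_left_cancel₀ (pow_ne_zero n hp) hpars
    simp_rw [hF _ hc, ← Finset.mul_sum] at hinv
    rw [hsum, hzero] at hinv
    apply ZMod.injective_stdAddChar
    apply mul_left_cancel₀ (pow_ne_zero n hp)
    rw [← hinv]
    linear_combination -(ZMod.stdAddChar (ip (e - d) (Fd 0)) : ℂ) *
      ((p : ℂ) ^ (n / 2) * (p : ℂ) ^ (n / 2) * hεε + hpn)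
  funext i
  simpa [ip, Pi.single_apply] using key (Pi.single i 1)

/-- Fibre cardinalities in terms of the character sums of the components. -/
lemma pow_mul_card_fiber {p n s : ℕ} [NeZero p] (F : (Fin n → ZMod p) → (Fin s → ZMod p))
    (i : Fin s → ZMod p) :
    (p : ℂ) ^ s * (Finset.univ.filter (fun x => F x = i)).card =
      ∑ c, walsh (fun x => ip c (F x)) 0 * ZMod.stdAddChar (-ip c i) := by
  simp_rw [walsh_eq, zero_ip, neg_zero, AddChar.map_zero_eq_one, mul_one, Finset.sum_mul,
    ← AddChar.map_add_eq_mul, ← sub_eq_add_neg, ← ip_sub]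
  rw [Finset.sum_comm]
  simp_rw [sum_stdAddChar_ip, sub_eq_zero]
  simp [Finset.sum_ite, mul_comm]

lemma pow_mul_card_fiber_of_walsh {p n s : ℕ} [NeZero p]
    {F Fd : (Fin n → ZMod p) → (Fin s → ZMod p)} {ε : ℤ}
    (hF : ∀ c : Fin s → ZMod p, c ≠ 0 → ∀ a : Fin n → ZMod p,
      walsh (fun x => ip c (F x)) a = (ε : ℂ) * (p : ℂ) ^ (n / 2) * zetaP p (ip c (Fd a)))
    (i : Fin s → ZMod p) :
    (p : ℤ) ^ s * (Finset.univ.filter (fun x => F x = i)).card =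
      p ^ n + ε * p ^ (n / 2) * ((if Fd 0 = i then (p : ℤ) ^ s else 0) - 1) := by
  simp_rw [zetaP_eq_stdAddChar] at hF
  have hsum := sum_stdAddChar_ip (p := p) (Fd 0 - i)
  rw [← Finset.add_sum_erase _ _ (Finset.mem_univ (0 : Fin s → ZMod p))] at hsum
  have hcount := pow_mul_card_fiber F i
  rw [← Finset.add_sum_erase _ _ (Finset.mem_univ (0 : Fin s → ZMod p))] at hcount
  have hterm : ∀ c ∈ Finset.univ.erase (0 : Fin s → ZMod p),
      walsh (fun x => ip c (F x)) 0 * (ZMod.stdAddChar (-ip c i) : ℂ) =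
        (ε : ℂ) * (p : ℂ) ^ (n / 2) * ZMod.stdAddChar (ip c (Fd 0 - i)) := by
    intro c hc
    rw [hF c (Finset.ne_of_mem_erase hc), mul_assoc, ← AddChar.map_add_eq_mul, ip_sub,
      sub_eq_add_neg]
  have hzero : walsh (fun x => ip 0 (F x)) 0 = (p : ℂ) ^ n := by
    simp [walsh_eq, zero_ip]
  rw [Finset.sum_congr rfl hterm, ← Finset.mul_sum, hzero, zero_ip, neg_zero,
    AddChar.map_zero_eq_one, mul_one] at hcount
  rw [zero_ip, AddChar.map_zero_eq_one] at hsum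
  simp_rw [sub_eq_zero] at hsum
  have hcast : ((p : ℂ) ^ s * (Finset.univ.filter (fun x => F x = i)).card) =
      p ^ n + ε * p ^ (n / 2) * ((if Fd 0 = i then (p : ℂ) ^ s else 0) - 1) := by
    rw [hcount, ← hsum, add_sub_cancel_left]
  split_ifs at hcast ⊢ <;> exact_mod_cast hcast

theorem stmt12 (p : ℕ) [Fact p.Prime] (n s : ℕ) (hn : 0 < n) (hneven : Even n)
    (hs : 0 < s) (hsn : s ≤ n / 2) (hps : Odd p ∨ 2 ≤ s)
    (F : (Fin n → ZMod p) → (Fin s → ZMod p)) (ε : ℤ)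
    (hε : ε = 1 ∨ ε = -1) (hε2 : p = 2 → ε = 1)
    (hF : ConditionA p F ε) :
    (((Finset.univ.filter (fun x => F x = F 0)).card : ℤ) =
        p ^ (n - s) + ε * p ^ (n / 2 - s) * (p ^ s - 1)) ∧
    ∀ i : Fin s → ZMod p, i ≠ F 0 →
      ((Finset.univ.filter (fun x => F x = i)).card : ℤ) =
        p ^ (n - s) - ε * p ^ (n / 2 - s) := by
  obtain ⟨Fd, hFd⟩ := hF
  have hp2 : 2 ≤ p := (Fact.out : p.Prime).two_le
  have hcard : 2 < p ^ s := by
    rcases hps with hodd | hs2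
    · have hp3 : 2 < p := lt_of_le_of_ne hp2 fun h => by
        rw [← h] at hodd
        exact absurd hodd (by decide)
      exact hp3.trans_le (Nat.le_self_pow hs.ne' p)
    · calc 2 < 2 ^ 2 := by norm_num
        _ ≤ p ^ 2 := Nat.pow_le_pow_left hp2 2
        _ ≤ p ^ s := Nat.pow_le_pow_right (by omega) hs2
  have hdual := vectorialDual_zero hneven hcard hε hFd
  have hps0 : (p : ℤ) ^ s ≠ 0 := pow_ne_zero s (by exact_mod_cast (by omega : p ≠ 0))
  have hn' : (p : ℤ) ^ n = p ^ s * p ^ (n - s) := by rw [← pow_add]; congr 1; omega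
  have hm' : (p : ℤ) ^ (n / 2) = p ^ s * p ^ (n / 2 - s) := by rw [← pow_add]; congr 1; omega
  refine ⟨mul_left_cancel₀ hps0 ?_, fun i hi => mul_left_cancel₀ hps0 ?_⟩
  · rw [pow_mul_card_fiber_of_walsh hFd, if_pos hdual, hn', hm']
    ring
  · rw [pow_mul_card_fiber_of_walsh hFd, if_neg (hdual.trans_ne hi.symm), hn', hm']
    ring
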